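/- Assume d ≥ 3, Ω is irreducible, and the torsion-free group Γ divides Ω. If F₁ and F₂ are distinct flats of Ω, then closure(F₁) ∩ closure(F₂) = ∅. -/

import Mathlib

open Set Filter Metric

noncomputable section

/-- `ℝ^d`. -/
abbrev Euc (d : ℕ) := EuclideanSpace ℝ (Fin d)

/-- A flat of `Ω` with prescribed vertices `v`. -/
def IsFlatWith {d : ℕ} (Ω : Set (Euc d)) (v : Fin d → Euc d) : Prop :=
  AffineIndependent ℝ v ∧
  (∀ j, v j ∈ closure Ω \ Ω) ∧
  intrinsicInterior ℝ (convexHull ℝ (Set.range v)) ⊆ Ω ∧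
  convexHull ℝ (Set.range v) \ intrinsicInterior ℝ (convexHull ℝ (Set.range v)) ⊆ closure Ω \ Ω

/-- A (codimension-one, properly embedded) flat of `Ω`. -/
def IsFlat {d : ℕ} (Ω : Set (Euc d)) (F : Set (Euc d)) : Prop :=
  ∃ v : Fin d → Euc d, IsFlatWith Ω v ∧ F = intrinsicInterior ℝ (convexHull ℝ (Set.range v))

/-- The cone over a subset of `ℝ^d`, inside `ℝ^d × ℝ ≅ ℝ^{d+1}`. -/
def coneOver {d : ℕ} (S : Set (Euc d)) : Set (Euc d × ℝ) :=
  {p | ∃ t : ℝ, 0 < t ∧ ∃ x ∈ S, p = t • (x, (1 : ℝ))}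

/-- Irreducibility of a properly convex domain: its cone admits no direct-sum
decomposition into convex cones. -/
def IsIrreducibleDomain {d : ℕ} (Ω : Set (Euc d)) : Prop :=
  ¬ ∃ (V₁ V₂ : Submodule ℝ (Euc d × ℝ)) (C₁ C₂ : Set (Euc d × ℝ)),
      V₁ ≠ ⊥ ∧ V₂ ≠ ⊥ ∧ V₁ ≠ ⊤ ∧ V₂ ≠ ⊤ ∧ IsCompl V₁ V₂ ∧
      C₁ ⊆ (V₁ : Set (Euc d × ℝ)) ∧ C₂ ⊆ (V₂ : Set (Euc d × ℝ)) ∧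
      Convex ℝ C₁ ∧ Convex ℝ C₂ ∧
      (∀ t : ℝ, 0 < t → ∀ c ∈ C₁, t • c ∈ C₁) ∧
      (∀ t : ℝ, 0 < t → ∀ c ∈ C₂, t • c ∈ C₂) ∧
      coneOver Ω = {p | ∃ c₁ ∈ C₁, ∃ c₂ ∈ C₂, p = c₁ + c₂}

/-- The homeomorphism of `Ω` induced by a linear automorphism of `ℝ^{d+1}`
preserving the cone over `Ω`. -/
def projAct {d : ℕ} (g : (Euc d × ℝ) ≃ₗ[ℝ] (Euc d × ℝ)) (x : Euc d) : Euc d :=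
  ((g (x, 1)).2)⁻¹ • (g (x, 1)).1

/-- `Γ` divides `Ω`: every element preserves the cone over `Ω`; the induced action on `Ω`
is free and properly discontinuous, and admits a compact set whose translates cover `Ω`. -/
def Divides {d : ℕ} (Ω : Set (Euc d))
    (Γ : Subgroup ((Euc d × ℝ) ≃ₗ[ℝ] (Euc d × ℝ))) : Prop :=
  (∀ γ ∈ Γ, (γ : (Euc d × ℝ) ≃ₗ[ℝ] (Euc d × ℝ)) '' coneOver Ω = coneOver Ω) ∧
  (∀ γ ∈ Γ, γ ≠ 1 → ∀ x ∈ Ω, projAct γ x ≠ x) ∧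
  (∀ K : Set (Euc d), K ⊆ Ω → IsCompact K →
    {γ : (Euc d × ℝ) ≃ₗ[ℝ] (Euc d × ℝ) | γ ∈ Γ ∧ (projAct γ '' K ∩ K).Nonempty}.Finite) ∧
  (∃ K : Set (Euc d), K ⊆ Ω ∧ IsCompact K ∧ (⋃ γ ∈ Γ, projAct γ '' K) = Ω)

/-- `Γ` is torsion-free. -/
def TorsionFreeSub {d : ℕ} (Γ : Subgroup ((Euc d × ℝ) ≃ₗ[ℝ] (Euc d × ℝ))) : Prop :=
  ∀ γ ∈ Γ, ∀ n : ℕ, n ≠ 0 → γ ^ n = 1 → γ = 1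

/-- Convergence of a sequence of flats: Hausdorff convergence of their closures. -/
def FlatsConverge {d : ℕ} (Fs : ℕ → Set (Euc d)) (F : Set (Euc d)) : Prop :=
  Tendsto (fun i => hausdorffDist (closure (Fs i)) (closure F)) atTop (nhds 0)

/-- A flat is isolated if no sequence of flats, all distinct from it, converges to it. -/
def IsIsolatedFlat {d : ℕ} (Ω F : Set (Euc d)) : Prop :=
  ¬ ∃ Fs : ℕ → Set (Euc d), (∀ i, IsFlat Ω (Fs i)) ∧ (∀ i, Fs i ≠ F) ∧ FlatsConverge Fs F

/-- The union of all flats of `Ω`. -/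
def flatsUnion {d : ℕ} (Ω : Set (Euc d)) : Set (Euc d) := ⋃₀ {F | IsFlat Ω F}

/-- A boundary flat: a flat contained in the closure of a connected component of the
complement of the union of all flats. -/
def IsBoundaryFlat {d : ℕ} (Ω F : Set (Euc d)) : Prop :=
  IsFlat Ω F ∧ ∃ x ∈ Ω \ flatsUnion Ω,
    F ⊆ closure (connectedComponentIn (Ω \ flatsUnion Ω) x)

section CocompactCone

open scoped Pointwise

variable {V : Type*} [NormedAddCommGroup V] [NormedSpace ℝ V]

/-- A nonempty open sharp convex cone on whose rays its group of linear automorphisms acts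
cocompactly. -/
structure CocompactCone (C : Set V) : Prop where
  isOpen : IsOpen C
  convex : Convex ℝ C
  nonempty : C.Nonempty
  smul_mem : ∀ t : ℝ, 0 < t → ∀ c ∈ C, t • c ∈ C
  sharp : ∃ l : V →L[ℝ] ℝ, ∀ c ∈ C, ‖c‖ ≤ l c
  cocompact : ∃ K ⊆ C, IsCompact K ∧
    ∀ x ∈ C, ∃ γ : V ≃L[ℝ] V, (∀ v, γ v ∈ C ↔ v ∈ C) ∧ ∃ k ∈ K, γ k = x

/-- A cone that decomposes as a direct sum of two convex cones. -/
def IsSplitCone (C : Set V) : Prop :=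
  ∃ (V₁ V₂ : Submodule ℝ V) (C₁ C₂ : Set V),
    V₁ ≠ ⊥ ∧ V₂ ≠ ⊥ ∧ V₁ ≠ ⊤ ∧ V₂ ≠ ⊤ ∧ IsCompl V₁ V₂ ∧
    C₁ ⊆ (V₁ : Set V) ∧ C₂ ⊆ (V₂ : Set V) ∧ Convex ℝ C₁ ∧ Convex ℝ C₂ ∧
    (∀ t : ℝ, 0 < t → ∀ c ∈ C₁, t • c ∈ C₁) ∧
    (∀ t : ℝ, 0 < t → ∀ c ∈ C₂, t • c ∈ C₂) ∧
    C = {p | ∃ c₁ ∈ C₁, ∃ c₂ ∈ C₂, p = c₁ + c₂}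

namespace CocompactCone

variable {C : Set V}

lemma smul_mem_closure (hC : CocompactCone C) {t : ℝ} (ht : 0 ≤ t) {y : V}
    (hy : y ∈ closure C) : t • y ∈ closure C := by
  rcases ht.eq_or_lt with rfl | ht
  · obtain ⟨c, hc⟩ := hC.nonempty
    rw [zero_smul]
    refine mem_closure_of_tendsto (f := fun s : ℝ => s • c) (b := nhdsWithin 0 (Ioi 0)) ?_ ?_
    · have : Tendsto (fun s : ℝ => s • c) (nhds 0) (nhds ((0 : ℝ) • c)) :=
        (continuous_id.smul continuous_const).tendsto 0
      rw [zero_smul] at this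
      exact this.mono_left nhdsWithin_le_nhds
    · filter_upwards [self_mem_nhdsWithin] with s hs using hC.smul_mem s hs c hc
  · exact map_mem_closure (continuous_const_smul t) hy (fun c hc => hC.smul_mem t ht c hc)

lemma add_mem (hC : CocompactCone C) {c y : V} (hc : c ∈ C) (hy : y ∈ closure C) :
    c + y ∈ C := by
  have h := hC.convex.combo_interior_closure_mem_interior (x := c) (y := y) (a := 1 / 2)
    (b := 1 / 2) (by rwa [hC.isOpen.interior_eq]) hy (by norm_num) (by norm_num) (by norm_num)
  rw [hC.isOpen.interior_eq] at h
  convert hC.smul_mem 2 (by norm_num) _ h using 1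
  rw [← smul_add, smul_smul]
  norm_num

lemma add_mem_closure (hC : CocompactCone C) {x y : V} (hx : x ∈ closure C)
    (hy : y ∈ closure C) : x + y ∈ closure C :=
  closure_closure (s := C) ▸ map_mem_closure (t := closure C) (f := fun z => z + y)
    (by fun_prop) hx (fun _ hc => subset_closure (hC.add_mem hc hy))

lemma sum_mem_closure (hC : CocompactCone C) {ι : Type*} (s : Finset ι) (a : ι → ℝ) (b : ι → V)
    (ha : ∀ i ∈ s, 0 ≤ a i) (hb : ∀ i ∈ s, b i ∈ closure C) :
    ∑ i ∈ s, a i • b i ∈ closure C := by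
  classical
  induction s using Finset.induction_on with
  | empty =>
    obtain ⟨c, hc⟩ := hC.nonempty
    simpa using hC.smul_mem_closure le_rfl (subset_closure hc)
  | insert i s hi ih =>
    rw [Finset.sum_insert hi]
    exact hC.add_mem_closure
      (hC.smul_mem_closure (ha i (by simp)) (hb i (by simp)))
      (ih (fun j hj => ha j (by simp [hj])) (fun j hj => hb j (by simp [hj])))

lemma mem_of_interior_closure (hC : CocompactCone C) {x : V} (hx : x ∈ interior (closure C)) :
    x ∈ C := by
  rw [hC.convex.interior_closure_eq_interior_of_nonempty_interior
    (by rw [hC.isOpen.interior_eq]; exact hC.nonempty), hC.isOpen.interior_eq] at hx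
  exact hx

lemma pos_of_nonneg (hC : CocompactCone C) {f : V →ₗ[ℝ] ℝ} (hf : ∀ c ∈ C, 0 ≤ f c)
    (hf0 : f ≠ 0) {c : V} (hc : c ∈ C) : 0 < f c := by
  refine (hf c hc).lt_of_ne fun h0 => hf0 ?_
  ext v
  have hcont : Tendsto (fun s : ℝ => c + s • v) (nhds 0) (nhds (c + (0 : ℝ) • v)) :=
    (Continuous.tendsto (by fun_prop) 0)
  rw [zero_smul, add_zero] at hcont
  obtain ⟨ε, hε, h⟩ := Metric.eventually_nhds_iff.1
    (hcont.eventually (hC.isOpen.mem_nhds hc))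
  have h1 := hf _ (h (y := ε / 2) (by simp [abs_of_pos hε, hε]))
  have h2 := hf _ (h (y := -(ε / 2)) (by simp [abs_of_pos hε, hε]))
  simp only [map_add, map_smul, ← h0, smul_eq_mul, zero_add] at h1 h2
  simp only [LinearMap.zero_apply]
  nlinarith

lemma nonneg_of_mem_closure [FiniteDimensional ℝ V] {f : V →ₗ[ℝ] ℝ} (hf : ∀ c ∈ C, 0 ≤ f c)
    {y : V} (hy : y ∈ closure C) : 0 ≤ f y :=
  closure_minimal (t := {y | 0 ≤ f y}) hf
    (isClosed_le continuous_const f.continuous_of_finiteDimensional) hy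

end CocompactCone

lemma mem_interior_preimage_of_map_eq {P : V →L[ℝ] V} {S : Set V} {v w : V}
    (hv : v ∈ interior (P ⁻¹' S)) (h : P v = P w) : w ∈ interior (P ⁻¹' S) := by
  obtain ⟨U, hU, hUo, hvU⟩ := mem_interior.1 hv
  refine mem_interior.2 ⟨(fun z => z - w + v) ⁻¹' U, fun z hz => ?_,
    hUo.preimage (by fun_prop), by simpa using hvU⟩
  have := hU hz
  simpa [h] using this

lemma opNorm_le_of_cone_bound {W : Type*} [NormedAddCommGroup W] [NormedSpace ℝ W]
    {T : V →L[ℝ] W} {m : W →L[ℝ] ℝ} {k : V} {ε : ℝ} (hε : 0 < ε)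
    (hT : ∀ v ∈ ball k ε, ‖T v‖ ≤ m (T v)) : ‖T‖ ≤ 2 * m (T k) / ε := by
  have hk : 0 ≤ m (T k) := (norm_nonneg _).trans (hT k (mem_ball_self hε))
  refine ContinuousLinearMap.opNorm_le_bound _ (by positivity) fun v => ?_
  rcases eq_or_ne v 0 with rfl | hv
  · simp
  have hv' : 0 < ‖v‖ := norm_pos_iff.2 hv
  set s : ℝ := ε / (2 * ‖v‖) with hs
  have hs0 : 0 < s := by positivity
  have hsn : ‖s • v‖ < ε := by
    rw [norm_smul, Real.norm_of_nonneg hs0.le, hs]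
    field_simp
    norm_num
  have h1 := hT (k + s • v) (by simpa using hsn)
  have h2 := hT (k - s • v) (by simpa [dist_eq_norm] using hsn)
  have h3 : 2 * ‖T (s • v)‖ ≤ 2 * m (T k) := by
    calc 2 * ‖T (s • v)‖ = ‖T (k + s • v) - T (k - s • v)‖ := by
          rw [← map_sub, show k + s • v - (k - s • v) = (2 : ℝ) • (s • v) by
            rw [two_smul]; abel, map_smul T 2, norm_smul]
          norm_num
      _ ≤ m (T (k + s • v)) + m (T (k - s • v)) := (norm_sub_le _ _).trans (add_le_add h1 h2)
      _ = 2 * m (T k) := by simp only [map_add, map_sub]; ring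
  rw [map_smul, norm_smul, Real.norm_of_nonneg hs0.le, hs] at h3
  rw [div_mul_eq_mul_div, le_div_iff₀ hε]
  rw [div_mul_eq_mul_div, mul_div_assoc'] at h3
  rw [div_le_iff₀ (by positivity)] at h3
  linarith

/-- The linear map that fixes the range of the projection `P` and scales its kernel by `t`. -/
def kernelScaling (P : V →L[ℝ] V) (t : ℝ) : V →L[ℝ] V :=
  P + t • (ContinuousLinearMap.id ℝ V - P)

lemma kernelScaling_apply (P : V →L[ℝ] V) (t : ℝ) (v : V) :
    kernelScaling P t v = P v + t • (v - P v) := by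
  simp [kernelScaling]

lemma kernelScaling_mul {P : V →L[ℝ] V} (hP : ∀ v, P (P v) = P v) {s t : ℝ} (hst : s * t = 1)
    (v : V) : kernelScaling P s (kernelScaling P t v) = v := by
  simp only [kernelScaling_apply, map_add, map_smul, map_sub, hP, sub_self, smul_zero, add_zero,
    add_sub_cancel_left, smul_smul, mul_comm t s, hst, one_smul]
  abel

lemma norm_kernelScaling_le {C : Set V} {P : V →L[ℝ] V} (hP : ∀ v, P (P v) = P v)
    {f l : V →L[ℝ] ℝ} (hl : ∀ c ∈ C, ‖c‖ ≤ l c) (hf : ∀ c ∈ C, ‖c - P c‖ ≤ f c)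
    (hfP : ∀ v, f (P v) = 0) {t : ℝ} (ht : 1 ≤ t) {c : V} (hc : c ∈ C) :
    ‖kernelScaling P t c‖ ≤
      (‖P‖ • l.comp P + (‖P‖ * ‖l‖ + 1) • f) (kernelScaling P t c) := by
  have hPy : P (kernelScaling P t c) = P c := by
    simp [kernelScaling_apply, hP]
  have hfy : f (kernelScaling P t c) = t * f c := by
    simp [kernelScaling_apply, hfP]
  have hf0 : 0 ≤ f c := (norm_nonneg _).trans (hf c hc)
  have h1 : ‖c‖ ≤ l (P c) + ‖l‖ * (t * f c) := by
    have h2 : l (c - P c) ≤ ‖l‖ * ‖c - P c‖ := (le_abs_self _).trans (l.le_opNorm _)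
    have h3 : l c = l (P c) + l (c - P c) := by simp
    have h4 : ‖l‖ * ‖c - P c‖ ≤ ‖l‖ * (t * f c) := by
      gcongr
      nlinarith [hf c hc]
    linarith [hl c hc]
  have h5 : ‖P c‖ ≤ ‖P‖ * (l (P c) + ‖l‖ * (t * f c)) :=
    (P.le_opNorm c).trans (by gcongr)
  have h6 : ‖t • (c - P c)‖ ≤ t * f c := by
    rw [norm_smul, Real.norm_of_nonneg (by linarith)]
    have := hf c hc
    gcongr
  have h7 : ‖kernelScaling P t c‖ ≤ ‖P c‖ + ‖t • (c - P c)‖ := by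
    rw [kernelScaling_apply]
    exact norm_add_le _ _
  simp only [add_apply, smul_apply,
    ContinuousLinearMap.comp_apply, smul_eq_mul, hPy, hfy]
  linarith

/-- The direct sum decomposition of the cone to which the cones `kernelScaling P t '' C` converge
as `t` tends to infinity. -/
def limitCone (C : Set V) (P : V →L[ℝ] V) : Set V :=
  {y | y ∈ interior (P ⁻¹' closure C) ∧ ∃ c ∈ C, y - P y = c - P c}

namespace CocompactCone

variable {C : Set V}

lemma isOpen_limitCone (hC : CocompactCone C) {P : V →L[ℝ] V} (hP : ∀ v, P (P v) = P v) :
    IsOpen (limitCone C P) := by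
  have : limitCone C P = interior (P ⁻¹' closure C) ∩ (C + {u | P u = u}) := by
    ext y
    constructor
    · rintro ⟨h, c, hc, hyc⟩
      refine ⟨h, c, hc, P (y - c), by simp [hP], ?_⟩
      simp only [map_sub]
      rw [sub_eq_sub_iff_add_eq_add] at hyc
      rw [← add_sub_assoc, ← hyc]
      abel
    · rintro ⟨h, c, hc, u, hu, rfl⟩
      refine ⟨h, c, hc, ?_⟩
      simp only [map_add, show P u = u from hu]
      abel
  rw [this]
  exact isOpen_interior.inter hC.isOpen.add_right

lemma eventually_mem_of_mem_limitCone (hC : CocompactCone C) {P : V →L[ℝ] V} {y : V}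
    (hy : y ∈ limitCone C P) : ∀ᶠ t : ℝ in atTop, kernelScaling P t⁻¹ y ∈ C := by
  obtain ⟨h, c, hc, hyc⟩ := hy
  have h1 : Tendsto (fun t : ℝ => y - t⁻¹ • c) atTop (nhds (y - (0 : ℝ) • c)) :=
    tendsto_const_nhds.sub (tendsto_inv_atTop_zero.smul_const c)
  rw [zero_smul, sub_zero] at h1
  filter_upwards [h1.eventually (isOpen_interior.mem_nhds h), eventually_gt_atTop 0]
    with t ht ht0
  have h2 := hC.add_mem (hC.smul_mem t⁻¹ (by positivity) c hc)
    (interior_subset (s := P ⁻¹' closure C) ht)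
  convert h2 using 1
  rw [kernelScaling_apply, hyc]
  simp only [map_sub, map_smul, smul_sub]
  abel

lemma image_subset_limitCone (hC : CocompactCone C) {P : V →L[ℝ] V} (hP : ∀ v, P (P v) = P v)
    (h : V ≃L[ℝ] V) {T : ℕ → V →L[ℝ] V} {t : ℕ → ℝ} (ht : Tendsto t atTop atTop)
    (hT : ∀ v, Tendsto (fun n => T n v) atTop (nhds (h v)))
    (hTC : ∀ n, ∀ c ∈ C, ∃ c' ∈ C, T n c = kernelScaling P (t n) c') {c : V} (hc : c ∈ C) :
    h c ∈ limitCone C P := by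
  have hopen : IsOpen (h '' C) := h.toHomeomorph.isOpenMap _ hC.isOpen
  have key : ∀ y ∈ h '' C, P y ∈ closure C ∧ y ∈ closure (C + {u | P u = u}) := by
    rintro _ ⟨c, hc, rfl⟩
    choose c' hc' hTc' using fun n => hTC n c hc
    have hlim := hT c
    constructor
    · have h1 : Tendsto (fun n => P (T n c)) atTop (nhds (P (h c))) :=
        (P.continuous.tendsto _).comp hlim
      have h2 : Tendsto (fun n => (t n)⁻¹ • (T n c - P (T n c))) atTop
          (nhds ((0 : ℝ) • (h c - P (h c)))) :=
        (tendsto_inv_atTop_zero.comp ht).smul (hlim.sub h1)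
      have h3 := h1.add h2
      rw [zero_smul, add_zero] at h3
      refine mem_closure_of_tendsto h3 ?_
      filter_upwards [ht.eventually_gt_atTop 0] with n hn
      have : P (T n c) + (t n)⁻¹ • (T n c - P (T n c)) = c' n := by
        rw [hTc' n, ← kernelScaling_apply]
        exact kernelScaling_mul hP (inv_mul_cancel₀ hn.ne') _
      rw [this]
      exact hc' n
    · refine mem_closure_of_tendsto hlim ?_
      filter_upwards [ht.eventually_gt_atTop 0] with n hn
      refine ⟨t n • c' n, hC.smul_mem _ hn _ (hc' n), P (c' n) - t n • P (c' n),
        by simp [hP], ?_⟩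
      simp only [hTc' n, kernelScaling_apply, smul_sub]
      abel
  have hcv : h c ∈ h '' C := mem_image_of_mem _ hc
  refine ⟨mem_interior.2 ⟨_, fun y hy => (key y hy).1, hopen, hcv⟩, ?_⟩
  have hconv : Convex ℝ (C + {u : V | P u = u}) :=
    hC.convex.add (LinearMap.eqLocus P.toLinearMap LinearMap.id).convex
  have hop : IsOpen (C + {u : V | P u = u}) := hC.isOpen.add_right
  have hint : h c ∈ interior (closure (C + {u : V | P u = u})) :=
    mem_interior.2 ⟨_, fun y hy => (key y hy).2, hopen, hcv⟩
  rw [hconv.interior_closure_eq_interior_of_nonempty_interior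
    (by
      rw [hop.interior_eq]
      exact hC.nonempty.add ⟨0, by simp⟩), hop.interior_eq] at hint
  obtain ⟨c', hc', u, hu, huc⟩ := hint
  refine ⟨c', hc', ?_⟩
  rw [← huc]
  simp only [map_add, show P u = u from hu]
  abel

/-- A cone that a linear automorphism maps onto `limitCone C P` splits. -/
lemma isSplitCone_of_image_eq (hC : CocompactCone C) {P : V →L[ℝ] V} (hP : ∀ v, P (P v) = P v)
    (hP0 : P ≠ 0) (hP1 : P ≠ ContinuousLinearMap.id ℝ V) (h : V ≃L[ℝ] V)
    (hh : ∀ v, v ∈ C ↔ h v ∈ limitCone C P) : IsSplitCone C := by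
  set Q : V →ₗ[ℝ] V := (h.symm : V →ₗ[ℝ] V) ∘ₗ (P : V →ₗ[ℝ] V) ∘ₗ (h : V →ₗ[ℝ] V) with hQ
  have hQa : ∀ v, Q v = h.symm (P (h v)) := fun v => rfl
  have hQQ : ∀ v, Q (Q v) = Q v := fun v => by simp [hQa, hP]
  have hhQ : ∀ v, h (Q v) = P (h v) := fun v => by simp [hQa]
  have hQ0 : Q ≠ 0 := fun h0 => hP0 <| by
    ext v
    have := hhQ (h.symm v)
    simpa [h0] using this.symm
  have hQ1 : Q ≠ LinearMap.id := fun h0 => hP1 <| by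
    ext v
    have := hhQ (h.symm v)
    simpa [h0] using this.symm
  have hcompl : IsCompl (LinearMap.range Q) (LinearMap.ker Q) :=
    LinearMap.IsIdempotentElem.isCompl (f := Q) (LinearMap.ext hQQ)
  have hr : LinearMap.range Q ≠ ⊥ := fun h0 => hQ0 (LinearMap.range_eq_bot.1 h0)
  have hk : LinearMap.ker Q ≠ ⊥ := fun h0 => hQ1 <| by
    ext v
    exact LinearMap.ker_eq_bot.1 h0 (hQQ v)
  have hconvI : Convex ℝ (interior (P ⁻¹' closure C)) :=
    (hC.convex.closure.linear_preimage (P : V →ₗ[ℝ] V)).interior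
  refine ⟨LinearMap.range Q, LinearMap.ker Q,
    {v | Q v = v ∧ h v ∈ interior (P ⁻¹' closure C)},
    {v | Q v = 0 ∧ ∃ c ∈ C, h v = c - P c}, hr, hk,
    fun h0 => hk (eq_bot_of_top_isCompl (h0 ▸ hcompl)),
    fun h0 => hr (eq_bot_of_top_isCompl (h0 ▸ hcompl.symm)), hcompl,
    fun v hv => ⟨v, hv.1⟩, fun v hv => hv.1, ?_, ?_, ?_, ?_, ?_⟩
  · rintro x ⟨hx1, hx2⟩ y ⟨hy1, hy2⟩ a b ha hb hab
    refine ⟨by simp [hx1, hy1], ?_⟩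
    rw [map_add, map_smul, map_smul]
    exact hconvI hx2 hy2 ha hb hab
  · rintro x ⟨hx1, c, hc, hx2⟩ y ⟨hy1, c', hc', hy2⟩ a b ha hb hab
    refine ⟨by simp [hx1, hy1], _, hC.convex hc hc' ha hb hab, ?_⟩
    simp only [map_add, map_smul, hx2, hy2, smul_sub]
    abel
  · rintro t ht x ⟨hx1, hx2⟩
    refine ⟨by simp [hx1], ?_⟩
    rw [map_smul]
    obtain ⟨U, hU, hUo, hxU⟩ := mem_interior.1 hx2
    refine mem_interior.2 ⟨(fun z => t⁻¹ • z) ⁻¹' U, fun z hz => ?_,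
      hUo.preimage (by fun_prop), by simpa [smul_smul, inv_mul_cancel₀ ht.ne'] using hxU⟩
    have := hC.smul_mem_closure ht.le (hU hz)
    simpa [smul_smul, mul_inv_cancel₀ ht.ne'] using this
  · rintro t ht x ⟨hx1, c, hc, hx2⟩
    exact ⟨by simp [hx1], _, hC.smul_mem t ht c hc, by simp [hx2, smul_sub]⟩
  · ext p
    rw [hh]
    constructor
    · rintro ⟨hp, c, hc, hpc⟩
      refine ⟨Q p, ⟨hQQ p, ?_⟩, p - Q p, ⟨by simp [hQQ], c, hc, ?_⟩, by simp⟩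
      · rw [hhQ]
        exact mem_interior_preimage_of_map_eq hp (hP _).symm
      · rw [map_sub, hhQ, hpc]
    · rintro ⟨c₁, ⟨h1, h2⟩, c₂, ⟨h3, c, hc, h4⟩, rfl⟩
      have h5 : P (h c₁) = h c₁ := by rw [← hhQ, h1]
      have h6 : P (h c₂) = 0 := by rw [← hhQ, h3, map_zero]
      refine ⟨mem_interior_preimage_of_map_eq h2 (by simp [h6]), c, hc, ?_⟩
      rw [map_add, map_add, h5, h6, h4]
      abel

end CocompactCone

namespace CocompactCone

variable {C : Set V} [FiniteDimensional ℝ V]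

/-- If `C` is sharp in the directions transverse to the range of a projection `P`, and the
intersection of `closure C` with this range is solid, then `C` splits: by cocompactness, `C` is
equivalent to the limit of the cones `kernelScaling P t '' C`. -/
theorem isSplitCone_of_projection (hC : CocompactCone C) {P : V →L[ℝ] V}
    (hP : ∀ v, P (P v) = P v) (hP0 : P ≠ 0) (hP1 : P ≠ ContinuousLinearMap.id ℝ V)
    {f : V →L[ℝ] ℝ} (hf : ∀ c ∈ C, ‖c - P c‖ ≤ f c) (hfP : ∀ v, f (P v) = 0)
    {x : V} (hx : x ∈ C) (hxP : x ∈ interior (P ⁻¹' closure C)) : IsSplitCone C := by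
  obtain ⟨l, hl⟩ := hC.sharp
  obtain ⟨K, hKC, hK, hcover⟩ := hC.cocompact
  obtain ⟨ε, hε, hεC⟩ := hK.exists_thickening_subset_open hC.isOpen hKC
  obtain ⟨δ, hδ, hδC⟩ := Metric.isOpen_iff.1 (hC.isOpen.inter isOpen_interior) x ⟨hx, hxP⟩
  have hball : ∀ t : ℝ, 1 ≤ t → ∀ y ∈ ball x δ, kernelScaling P t⁻¹ y ∈ C := by
    intro t ht y hy
    obtain ⟨hyC, hyP⟩ := hδC hy
    have ht0 : 0 < t := by linarith
    have h1 := hC.add_mem (hC.smul_mem t⁻¹ (by positivity) y hyC)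
      (hC.smul_mem_closure (sub_nonneg.2 (inv_le_one_of_one_le₀ ht))
        (interior_subset (s := P ⁻¹' closure C) hyP))
    convert h1 using 1
    rw [kernelScaling_apply, sub_smul, one_smul, smul_sub]
    abel
  set t : ℕ → ℝ := fun n => (n : ℝ) + 1 with ht
  have ht1 : ∀ n, 1 ≤ t n := fun n => by simp [ht]
  have ht0 : ∀ n, t n ≠ 0 := fun n => (by linarith [ht1 n] : 0 < t n).ne'
  choose γ hγ k hkK hγk using fun n => hcover _ (hball (t n) (ht1 n) x (mem_ball_self hδ))
  set T : ℕ → V →L[ℝ] V := fun n => (kernelScaling P (t n)).comp (γ n : V →L[ℝ] V) with hT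
  set S : ℕ → V →L[ℝ] V :=
    fun n => ((γ n).symm : V →L[ℝ] V).comp (kernelScaling P (t n)⁻¹) with hS
  have hST : ∀ n v, S n (T n v) = v := fun n v => by
    simp [hS, hT, kernelScaling_mul hP (inv_mul_cancel₀ (ht0 n))]
  have hTS : ∀ n v, T n (S n v) = v := fun n v => by
    simp [hS, hT, kernelScaling_mul hP (mul_inv_cancel₀ (ht0 n))]
  have hγs : ∀ n v, v ∈ C → (γ n).symm v ∈ C := fun n v hv => by
    rw [← hγ n]
    simpa using hv
  have hTk : ∀ n, T n (k n) = x := fun n => by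
    simp [hT, hγk, kernelScaling_mul hP (mul_inv_cancel₀ (ht0 n))]
  have hSx : ∀ n, S n x = k n := fun n => by rw [← hTk n, hST]
  have hTC : ∀ n, ∀ c ∈ C, ∃ c' ∈ C, T n c = kernelScaling P (t n) c' :=
    fun n c hc => ⟨γ n c, (hγ n c).2 hc, rfl⟩
  obtain ⟨R, hR⟩ := hK.bddAbove_image l.continuous.continuousOn
  set m : V →L[ℝ] ℝ := ‖P‖ • l.comp P + (‖P‖ * ‖l‖ + 1) • f
  have hTn : ∀ n, ‖T n‖ ≤ 2 * m x / ε := fun n => by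
    rw [← hTk n]
    refine opNorm_le_of_cone_bound hε fun v hv => ?_
    have hvC : v ∈ C := hεC (Metric.mem_thickening_iff.2 ⟨k n, hkK n, hv⟩)
    exact norm_kernelScaling_le hP hl hf hfP (ht1 n) ((hγ n v).2 hvC)
  have hSn : ∀ n, ‖S n‖ ≤ 2 * R / δ := fun n => by
    refine (opNorm_le_of_cone_bound hδ (m := l) (k := x) fun v hv =>
      hl _ (hγs n _ (hball (t n) (ht1 n) v hv))).trans ?_
    have : l (S n x) ≤ R := hR ⟨_, hkK n, by rw [hSx]⟩
    gcongr
  have : ProperSpace (V →L[ℝ] V) := FiniteDimensional.proper ℝ _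
  obtain ⟨⟨A, B⟩, -, φ, hφ, hlim⟩ := tendsto_subseq_of_bounded
    (s := closedBall (0 : V →L[ℝ] V) (2 * m x / ε) ×ˢ closedBall (0 : V →L[ℝ] V) (2 * R / δ))
    (isBounded_closedBall.prod isBounded_closedBall) (x := fun n => (T n, S n))
    (fun n => ⟨by simpa using hTn n, by simpa using hSn n⟩)
  have hA : Tendsto (fun n => T (φ n)) atTop (nhds A) :=
    (continuous_fst.tendsto (A, B)).comp hlim
  have hB : Tendsto (fun n => S (φ n)) atTop (nhds B) :=
    (continuous_snd.tendsto (A, B)).comp hlim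
  have hAv : ∀ v, Tendsto (fun n => T (φ n) v) atTop (nhds (A v)) := fun v =>
    ((ContinuousLinearMap.apply ℝ V v).continuous.tendsto A).comp hA
  have hBv : ∀ v, Tendsto (fun n => S (φ n) v) atTop (nhds (B v)) := fun v =>
    ((ContinuousLinearMap.apply ℝ V v).continuous.tendsto B).comp hB
  have hAB : ∀ v, A (B v) = v := fun v =>
    tendsto_nhds_unique (((isBoundedBilinearMap_apply (𝕜 := ℝ)).continuous.tendsto (A, B v) |>.comp
      (hA.prodMk_nhds (hBv v))).congr fun n => hTS _ v) tendsto_const_nhds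
  have hBA : ∀ v, B (A v) = v := fun v =>
    tendsto_nhds_unique (((isBoundedBilinearMap_apply (𝕜 := ℝ)).continuous.tendsto (B, A v) |>.comp
      (hB.prodMk_nhds (hAv v))).congr fun n => hST _ v) tendsto_const_nhds
  set h : V ≃L[ℝ] V := ContinuousLinearEquiv.equivOfInverse A B hBA hAB with hh
  have htφ : Tendsto (fun n => t (φ n)) atTop atTop :=
    (tendsto_atTop_add_const_right _ _ tendsto_natCast_atTop_atTop).comp hφ.tendsto_atTop
  refine hC.isSplitCone_of_image_eq hP hP0 hP1 h fun v =>
    ⟨fun hv => hC.image_subset_limitCone hP h htφ hAv (fun n => hTC _) hv, fun hv => ?_⟩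
  refine hC.mem_of_interior_closure (mem_interior.2
    ⟨h ⁻¹' limitCone C P, fun w hw => ?_,
      (hC.isOpen_limitCone hP).preimage h.continuous, hv⟩)
  rw [← show B (h w) = w from hBA w]
  refine mem_closure_of_tendsto (hBv _) ?_
  filter_upwards [htφ.eventually (hC.eventually_mem_of_mem_limitCone hw)] with n hn
  exact hγs _ _ hn

/-- A face spanned by linearly independent vectors `b` together with linearly independent
supporting forms `g` vanishing on it, `card ι + card κ` being the dimension, splits the cone. -/
theorem isSplitCone_of_face (hC : CocompactCone C) {ι κ : Type*} [Fintype ι] [Fintype κ]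
    [Nonempty ι] [Nonempty κ] {b : ι → V} {g : κ → V →ₗ[ℝ] ℝ} (hb : LinearIndependent ℝ b)
    (hg : LinearIndependent ℝ g) (hbC : ∀ i, b i ∈ closure C) (hgC : ∀ j, ∀ c ∈ C, 0 ≤ g j c)
    (hgb : ∀ j i, g j (b i) = 0)
    (hcard : Fintype.card ι + Fintype.card κ = Module.finrank ℝ V) : IsSplitCone C := by
  classical
  obtain ⟨lam, hlam⟩ : ∃ lam : ι → V →ₗ[ℝ] ℝ, ∀ i j, lam i (b j) = if i = j then 1 else 0 := by
    obtain ⟨L, hL⟩ := LinearMap.exists_leftInverse_of_injective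
      (Fintype.linearCombination ℝ b) (LinearMap.ker_eq_bot.2
        (linearIndependent_iff_injective_fintypeLinearCombination.1 hb))
    refine ⟨fun i => LinearMap.proj i ∘ₗ L, fun i j => ?_⟩
    have := LinearMap.congr_fun hL (Pi.single j 1)
    simp only [LinearMap.comp_apply, Fintype.linearCombination_apply_single, one_smul,
      LinearMap.id_apply] at this
    simp [this, Pi.single_apply]
  set P₀ : V →ₗ[ℝ] V := ∑ i, (lam i).smulRight (b i) with hP₀
  set P : V →L[ℝ] V := LinearMap.toContinuousLinearMap P₀ with hPdef
  have hPv : ∀ v, P v = ∑ i, lam i v • b i := fun v => by simp [hPdef, hP₀]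
  have hPb : ∀ j, P (b j) = b j := fun j => by simp [hPv, hlam]
  have hPP : ∀ v, P (P v) = P v := fun v => by
    rw [hPv v, map_sum]
    simp [hPb]
  set G : V →ₗ[ℝ] (κ → ℝ) := LinearMap.pi g with hG
  have hGP : ∀ v, G (P v) = 0 := fun v => by
    ext j
    simp [hG, hPv, hgb]
  have hspan : Submodule.span ℝ (range b) =
      (Submodule.span ℝ (range g) : Subspace ℝ (Module.Dual ℝ V)).dualCoannihilator := by
    refine Submodule.eq_of_le_of_finrank_eq (Submodule.span_le.2 ?_) ?_
    · rintro _ ⟨i, rfl⟩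
      rw [SetLike.mem_coe, Submodule.mem_dualCoannihilator]
      intro φ hφ
      induction hφ using Submodule.span_induction with
      | mem φ hφ => obtain ⟨j, rfl⟩ := hφ; exact hgb j i
      | zero => rfl
      | add φ ψ _ _ h1 h2 => simp [h1, h2]
      | smul a φ _ h1 => simp [h1]
    · have h1 := Subspace.finrank_add_finrank_dualCoannihilator_eq
        (Submodule.span ℝ (range g) : Subspace ℝ (Module.Dual ℝ V))
      have h2 : Module.finrank ℝ
          (Submodule.span ℝ (range g) : Subspace ℝ (Module.Dual ℝ V)) = Fintype.card κ :=
        finrank_span_eq_card hg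
      rw [finrank_span_eq_card hb]
      omega
  have hker : ∀ v, G v = 0 → P v = v := by
    intro v hv
    have hv' : v ∈ Submodule.span ℝ (range b) := by
      rw [hspan, Submodule.mem_dualCoannihilator]
      intro φ hφ
      induction hφ using Submodule.span_induction with
      | mem φ hφ => obtain ⟨j, rfl⟩ := hφ; exact congr_fun hv j
      | zero => rfl
      | add φ ψ _ _ h1 h2 => simp [h1, h2]
      | smul a φ _ h1 => simp [h1]
    clear hv
    induction hv' using Submodule.span_induction with
    | mem v hv => obtain ⟨j, rfl⟩ := hv; exact hPb j
    | zero => simp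
    | add v w _ _ h1 h2 => rw [map_add, h1, h2]
    | smul a v _ h1 => rw [map_smul, h1]
  obtain ⟨L, hL⟩ : ∃ L : (κ → ℝ) →ₗ[ℝ] V, ∀ v, L (G v) = v - P v := by
    obtain ⟨s, hs⟩ := LinearMap.exists_rightInverse_of_surjective G.rangeRestrict
      G.range_rangeRestrict
    obtain ⟨s', hs'⟩ := LinearMap.exists_extend s
    refine ⟨(LinearMap.id - P₀) ∘ₗ s', fun v => ?_⟩
    have h1 : G (s' (G v)) = G v := by
      have h2 := LinearMap.congr_fun hs' (G.rangeRestrict v)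
      have h3 := congr_arg Subtype.val (LinearMap.congr_fun hs (G.rangeRestrict v))
      simp only [LinearMap.comp_apply, Submodule.subtype_apply] at h2
      rw [show s' (G v) = s (G.rangeRestrict v) from h2]
      exact h3
    have h4 := hker (s' (G v) - v) (by rw [map_sub, h1, sub_self])
    change s' (G v) - P (s' (G v)) = v - P v
    rw [map_sub] at h4
    rw [sub_eq_sub_iff_sub_eq_sub, h4]
  set Lc : (κ → ℝ) →L[ℝ] V := LinearMap.toContinuousLinearMap L
  set f : V →L[ℝ] ℝ := ‖Lc‖ • LinearMap.toContinuousLinearMap (∑ j, g j) with hf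
  obtain ⟨c₀, hc₀⟩ := hC.nonempty
  have hlim : ∀ i, ∀ᶠ s : ℝ in nhdsWithin 0 (Ioi 0), 0 < s * lam i c₀ + 1 := fun i => by
    have : Tendsto (fun s : ℝ => s * lam i c₀ + 1) (nhds 0) (nhds (0 * lam i c₀ + 1)) :=
      Continuous.tendsto (by fun_prop) 0
    exact (this.mono_left nhdsWithin_le_nhds).eventually (lt_mem_nhds (by simp))
  obtain ⟨s, hs, hs0⟩ := ((eventually_all.2 hlim).and self_mem_nhdsWithin).exists
  have hx : s • c₀ + ∑ i, (1 : ℝ) • b i ∈ C := hC.add_mem (hC.smul_mem s hs0 c₀ hc₀)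
    (hC.sum_mem_closure _ _ _ (fun _ _ => zero_le_one) fun i _ => hbC i)
  refine hC.isSplitCone_of_projection hPP (fun h0 => ?_) (fun h1 => ?_) (f := f) (fun c hc => ?_)
    (fun v => ?_) hx (mem_interior.2 ⟨{v | ∀ i, 0 < lam i v}, fun v hv => ?_, ?_, fun i => ?_⟩)
  · obtain ⟨i⟩ := ‹Nonempty ι›
    exact hb.ne_zero i (by rw [← hPb i, h0]; rfl)
  · obtain ⟨j⟩ := ‹Nonempty κ›
    refine hg.ne_zero j (LinearMap.ext fun v => ?_)
    have := congr_fun (hGP v) j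
    rwa [h1] at this
  · have hGc : ‖G c‖ ≤ ∑ j, g j c := by
      refine (pi_norm_le_iff_of_nonneg (Finset.sum_nonneg fun j _ => hgC j c hc)).2 fun j => ?_
      rw [show G c j = g j c from rfl, Real.norm_of_nonneg (hgC j c hc)]
      exact Finset.single_le_sum (f := fun j => g j c) (fun j _ => hgC j c hc)
        (Finset.mem_univ j)
    rw [← hL]
    calc ‖L (G c)‖ ≤ ‖Lc‖ * ‖G c‖ := Lc.le_opNorm _
      _ ≤ ‖Lc‖ * ∑ j, g j c := by gcongr
      _ = f c := by simp [hf]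
  · have : ∀ j, g j (P v) = 0 := fun j => congr_fun (hGP v) j
    simp [hf, this]
  · rw [mem_preimage, hPv]
    exact hC.sum_mem_closure _ _ _ (fun i _ => (hv i).le) fun i _ => hbC i
  · rw [ofPred_forall]
    exact isOpen_iInter_of_finite fun i =>
      isOpen_lt continuous_const (lam i).continuous_of_finiteDimensional
  · simpa [hlam] using hs i

end CocompactCone

lemma form_eq_zero_of_sum {ι : Type*} {e : ι → V} {x : V} {g : V →ₗ[ℝ] ℝ} {s : Finset ι} {a : ι → ℝ}
    (hx : x = ∑ i ∈ s, a i • e i) (ha : ∀ i ∈ s, 0 ≤ a i) (hg : ∀ i ∈ s, 0 ≤ g (e i))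
    (hgx : g x = 0) {i : ι} (hi : i ∈ s) (hai : 0 < a i) : g (e i) = 0 := by
  rw [hx, map_sum] at hgx
  simp only [map_smul, smul_eq_mul] at hgx
  have := (Finset.sum_eq_zero_iff_of_nonneg fun i hi => mul_nonneg (ha i hi) (hg i hi)).1 hgx i hi
  exact (mul_eq_zero.1 this).resolve_left hai.ne'

/-- The vertices `e` of a codimension-one simplicial section of the cone `C`, together with
forms `f` dual to them and supporting `C` along the facets of the section. -/
structure SimplicialFrame {ι : Type*} [Fintype ι] [DecidableEq ι] (C : Set V) (e : ι → V)
    (f : ι → V →ₗ[ℝ] ℝ) : Prop where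
  mem_closure : ∀ i, e i ∈ closure C
  nonneg : ∀ i, ∀ c ∈ C, 0 ≤ f i c
  dual : ∀ i j, f i (e j) = if i = j then 1 else 0
  mem_of_pos : ∀ a : ι → ℝ, (∀ i, 0 < a i) → ∑ i, a i • e i ∈ C
  card_eq : Fintype.card ι + 1 = Module.finrank ℝ V

namespace SimplicialFrame

variable {C : Set V} {ι κ : Type*} [Fintype ι] [DecidableEq ι] [Fintype κ] [DecidableEq κ]
  {e : ι → V} {f : ι → V →ₗ[ℝ] ℝ} {e' : κ → V} {f' : κ → V →ₗ[ℝ] ℝ}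

lemma linearIndependent (hF : SimplicialFrame C e f) : LinearIndependent ℝ e := by
  rw [Fintype.linearIndependent_iff]
  intro a ha i
  simpa [hF.dual] using congr_arg (f i) ha

lemma linearIndependent_form (hF : SimplicialFrame C e f) : LinearIndependent ℝ f := by
  rw [Fintype.linearIndependent_iff]
  intro a ha i
  simpa [hF.dual] using LinearMap.congr_fun ha (e i)

lemma eq_sum_of_mem_span (hF : SimplicialFrame C e f) {y : V}
    (hy : y ∈ Submodule.span ℝ (range e)) : y = ∑ i, f i y • e i := by
  induction hy using Submodule.span_induction with
  | mem y hy => obtain ⟨j, rfl⟩ := hy; simp [hF.dual]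
  | zero => simp
  | add y z _ _ hy hz =>
    nth_rewrite 1 [hy, hz]
    simp [add_smul, Finset.sum_add_distrib]
  | smul a y _ hy =>
    nth_rewrite 1 [hy]
    simp [Finset.smul_sum, mul_smul]

lemma form_pos (hF : SimplicialFrame C e f) (hC : CocompactCone C) (i : ι) {c : V}
    (hc : c ∈ C) : 0 < f i c :=
  hC.pos_of_nonneg (hF.nonneg i) (hF.linearIndependent_form.ne_zero i) hc

variable [FiniteDimensional ℝ V]

lemma form_nonneg (hF : SimplicialFrame C e f) (i : ι) {y : V} (hy : y ∈ closure C) :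
    0 ≤ f i y :=
  CocompactCone.nonneg_of_mem_closure (hF.nonneg i) hy

/-- In an indecomposable cone, the closed face cut out by some of the supporting forms is spanned
by the vertices it contains. -/
lemma eq_sum_of_form_eq_zero (hF : SimplicialFrame C e f) (hC : CocompactCone C)
    (hirr : ¬ IsSplitCone C) {I : Finset ι} (hI : I ≠ Finset.univ) {y : V}
    (hy : y ∈ closure C) (hfy : ∀ j ∉ I, f j y = 0) : y = ∑ i ∈ I, f i y • e i := by
  have hmem : y ∈ Submodule.span ℝ (range fun i : I => e i) := by
    by_contra hn
    refine hirr ?_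
    have : Nonempty (↥(Iᶜ)) := by
      rw [← Finset.coe_sort_coe, nonempty_coe_sort, Finset.coe_nonempty]
      rwa [Finset.nonempty_iff_ne_empty, Ne, Finset.compl_eq_empty_iff]
    refine hC.isSplitCone_of_face (ι := Option I) (κ := ↥(Iᶜ))
      (b := fun o => o.casesOn' y fun i : I => e i) (g := fun j => f j)
      ((hF.linearIndependent.comp _ Subtype.val_injective).option hn)
      (hF.linearIndependent_form.comp _ Subtype.val_injective) ?_
      (fun j c hc => hF.nonneg j c hc) ?_ ?_
    · rintro (_ | i)
      exacts [hy, hF.mem_closure i]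
    · rintro ⟨j, hj⟩ (_ | i)
      · exact hfy j (Finset.mem_compl.1 hj)
      · have : j ≠ i := fun h => Finset.mem_compl.1 hj (h ▸ i.2)
        simp [hF.dual, this]
    · have := hF.card_eq
      have := Finset.card_le_univ I
      simp only [Fintype.card_option, Fintype.card_coe, Finset.card_compl]
      omega
  have h := hF.eq_sum_of_mem_span (Submodule.span_mono (range_comp_subset_range _ _) hmem)
  rw [Finset.sum_subset (Finset.subset_univ I) fun j _ hj => by rw [hfy j hj, zero_smul]]
  exact h

/-- In an indecomposable cone, the supporting forms of the section span the space of supporting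
forms at each of its vertices. -/
lemma form_eq_sum_of_eq_zero (hF : SimplicialFrame C e f) (hC : CocompactCone C)
    (hirr : ¬ IsSplitCone C) {i : ι} {g : V →ₗ[ℝ] ℝ} (hg : ∀ c ∈ C, 0 ≤ g c)
    (hgi : g (e i) = 0) : g = ∑ k, g (e k) • f k := by
  have hmem : g ∈ Submodule.span ℝ (range fun k : {k // k ≠ i} => f k) := by
    by_contra hn
    refine hirr ?_
    refine hC.isSplitCone_of_face (ι := Unit) (κ := Option {k // k ≠ i}) (b := fun _ => e i)
      (g := fun o => o.casesOn' g fun k : {k // k ≠ i} => f k)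
      (.of_subsingleton () (hF.linearIndependent.ne_zero i))
      ((hF.linearIndependent_form.comp _ Subtype.val_injective).option hn)
      (fun _ => hF.mem_closure i) ?_ ?_ ?_
    · rintro (_ | k)
      exacts [hg, hF.nonneg k]
    · rintro (_ | k) _
      · exact hgi
      · simp [hF.dual, k.2]
    · have := hF.card_eq
      have : 0 < Fintype.card ι := Fintype.card_pos_iff.2 ⟨i⟩
      simp only [Fintype.card_option, Fintype.card_subtype_compl,
        Fintype.card_unique]
      omega
  have hmem' := Submodule.span_mono (range_comp_subset_range _ _) hmem
  clear hmem hg hgi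
  induction hmem' using Submodule.span_induction with
  | mem g hg => obtain ⟨j, rfl⟩ := hg; simp [hF.dual]
  | zero => simp
  | add g g' _ _ hg hg' =>
    nth_rewrite 1 [hg, hg']
    simp [add_smul, Finset.sum_add_distrib]
  | smul a g _ hg =>
    nth_rewrite 1 [hg]
    simp [Finset.smul_sum, mul_smul]

/-- Two sections meeting in a boundary point share a vertex. -/
lemma exists_common_vertex (hF : SimplicialFrame C e f) (hG : SimplicialFrame C e' f')
    (hC : CocompactCone C) (hirr : ¬ IsSplitCone C) (hcard : 2 ≤ Fintype.card ι)
    {h : V →ₗ[ℝ] ℝ} (he : ∀ i, h (e i) = 1) (he' : ∀ j, h (e' j) = 1) {y : V} (hy0 : y ≠ 0)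
    (hy : y ∈ closure C) (hyC : y ∉ C) (hye : y = ∑ i, f i y • e i)
    (hye' : y = ∑ j, f' j y • e' j) : ∃ i j, e i = e' j := by
  set J := Finset.univ.filter fun j => 0 < f' j y with hJ
  have hJu : J ≠ Finset.univ := fun h0 => hyC <| by
    rw [hye']
    refine hG.mem_of_pos _ fun j => ?_
    have : j ∈ J := h0 ▸ Finset.mem_univ j
    simpa [hJ] using this
  obtain ⟨i, hi⟩ : ∃ i, 0 < f i y := by
    by_contra! hn
    refine hy0 ?_
    rw [hye]
    exact Finset.sum_eq_zero fun i _ => by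
      rw [le_antisymm (hn i) (hF.form_nonneg i hy), zero_smul]
  have hei : e i = ∑ j ∈ J, f' j (e i) • e' j := by
    refine hG.eq_sum_of_form_eq_zero hC hirr hJu (hF.mem_closure i) fun j hj => ?_
    refine form_eq_zero_of_sum hye (fun i _ => hF.form_nonneg i hy)
      (fun i _ => hG.form_nonneg j (hF.mem_closure i)) ?_ (Finset.mem_univ i) hi
    exact le_antisymm (by simpa [hJ] using hj) (hG.form_nonneg j hy)
  obtain ⟨j, hj, hjpos⟩ : ∃ j ∈ J, 0 < f' j (e i) := by
    by_contra! hn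
    refine hF.linearIndependent.ne_zero i ?_
    rw [hei]
    exact Finset.sum_eq_zero fun j hj => by
      rw [le_antisymm (hn j hj) (hG.form_nonneg j (hF.mem_closure i)), zero_smul]
  have hej : e' j = ∑ k ∈ {i}, f k (e' j) • e k := by
    refine hF.eq_sum_of_form_eq_zero hC hirr (fun h0 => ?_)
      (hG.mem_closure j) fun k hk => ?_
    · have := congr_arg Finset.card h0
      rw [Finset.card_singleton, Finset.card_univ] at this
      omega
    · refine form_eq_zero_of_sum hei
        (fun j _ => hG.form_nonneg j (hF.mem_closure i))
        (fun j _ => hF.form_nonneg k (hG.mem_closure j)) ?_ hj hjpos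
      simpa [hF.dual] using hk
  rw [Finset.sum_singleton] at hej
  have h1 : f i (e' j) = 1 := by
    have := congr_arg h hej
    simpa [he, he'] using this.symm
  exact ⟨i, j, by rw [hej, h1, one_smul]⟩

/-- If two sections share a vertex, then away from that vertex their supporting forms agree up to
scaling. -/
lemma exists_form_eq_smul (hF : SimplicialFrame C e f) (hG : SimplicialFrame C e' f')
    (hC : CocompactCone C) (hirr : ¬ IsSplitCone C) {i : ι} {j : κ} (hij : e i = e' j) {k : ι}
    (hk : k ≠ i) : ∃ l, l ≠ j ∧ 0 < f k (e' l) ∧ ∃ c : ℝ, c ≠ 0 ∧ f' l = c • f k := by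
  have hfk := hG.form_eq_sum_of_eq_zero hC hirr (i := j) (hF.nonneg k)
    (by rw [← hij, hF.dual, if_neg hk])
  obtain ⟨l, hl⟩ : ∃ l, 0 < f k (e' l) := by
    by_contra! hn
    refine hF.linearIndependent_form.ne_zero k ?_
    rw [hfk]
    exact Finset.sum_eq_zero fun l _ => by
      rw [le_antisymm (hn l) (hF.form_nonneg k (hG.mem_closure l)), zero_smul]
  have hlj : l ≠ j := by
    rintro rfl
    rw [← hij, hF.dual, if_neg hk] at hl
    exact hl.false
  have hfl := hF.form_eq_sum_of_eq_zero hC hirr (i := i) (hG.nonneg l)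
    (by rw [hij, hG.dual, if_neg hlj])
  have hzero : ∀ m, m ≠ k → f' l (e m) = 0 := by
    intro m hm
    have h1 := LinearMap.congr_fun hfk (e m)
    rw [hF.dual, if_neg hm.symm, LinearMap.sum_apply] at h1
    simp only [LinearMap.smul_apply, smul_eq_mul] at h1
    have h2 := (Finset.sum_eq_zero_iff_of_nonneg fun l _ => mul_nonneg
      (hF.form_nonneg k (hG.mem_closure l)) (hG.form_nonneg l (hF.mem_closure m))).1 h1.symm l
      (Finset.mem_univ l)
    exact (mul_eq_zero.1 h2).resolve_left hl.ne'
  rw [Finset.sum_eq_single k (fun m _ hm => by rw [hzero m hm, zero_smul]) (by simp)] at hfl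
  refine ⟨l, hlj, hl, f' l (e k), fun h0 => ?_, hfl⟩
  exact hG.linearIndependent_form.ne_zero l (by rw [hfl, h0, zero_smul])

/-- Two sections sharing a vertex share all their vertices. -/
lemma range_subset_of_common_vertex (hF : SimplicialFrame C e f) (hG : SimplicialFrame C e' f')
    (hC : CocompactCone C) (hirr : ¬ IsSplitCone C) (hcard : 3 ≤ Fintype.card ι)
    {h : V →ₗ[ℝ] ℝ} (he : ∀ i, h (e i) = 1) (he' : ∀ j, h (e' j) = 1) {i : ι} {j : κ}
    (hij : e i = e' j) : range e ⊆ range e' := by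
  rintro _ ⟨k, rfl⟩
  rcases eq_or_ne k i with rfl | hk
  · exact ⟨j, hij.symm⟩
  obtain ⟨l, hlj, hl, c, hc0, hc⟩ := hF.exists_form_eq_smul hG hC hirr hij hk
  have hel : e' l = ∑ m ∈ {i, k}, f m (e' l) • e m := by
    refine hF.eq_sum_of_form_eq_zero hC hirr (fun h0 => ?_)
      (hG.mem_closure l) fun m hm => ?_
    · have := congr_arg Finset.card h0
      rw [Finset.card_univ, Finset.card_pair hk.symm] at this
      omega
    · simp only [Finset.mem_insert, Finset.mem_singleton, not_or] at hm
      obtain ⟨l', -, -, c', hc'0, hc'⟩ := hF.exists_form_eq_smul hG hC hirr hij hm.1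
      have hll : l' ≠ l := by
        rintro rfl
        have := LinearMap.congr_fun (hc.symm.trans hc') (e m)
        simp only [LinearMap.smul_apply, hF.dual, if_neg (Ne.symm hm.2), if_true, smul_eq_mul,
          mul_zero, mul_one] at this
        exact hc'0 this.symm
      have := LinearMap.congr_fun hc' (e' l)
      rw [hG.dual, if_neg hll, LinearMap.smul_apply, smul_eq_mul] at this
      exact (mul_eq_zero.1 this.symm).resolve_left hc'0
  rw [Finset.sum_pair hk.symm] at hel
  have hfi : f i (e' l) = 0 := by
    have h1 := congr_arg (f' j) hel
    rw [hG.dual, if_neg hlj.symm, map_add, map_smul, map_smul, hij, hG.dual, if_pos rfl,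
      smul_eq_mul, smul_eq_mul, mul_one] at h1
    have h2 := hF.form_nonneg i (hG.mem_closure l)
    have h3 := mul_nonneg hl.le (hG.form_nonneg j (hF.mem_closure k))
    linarith
  rw [hfi, zero_smul, zero_add] at hel
  have h1 : f k (e' l) = 1 := by
    have := congr_arg h hel
    simpa [he, he'] using this.symm
  exact ⟨l, by rw [hel, h1, one_smul]⟩

/-- The spans of two sections that meet contain a common boundary ray. -/
lemma exists_common_boundary_point (hF : SimplicialFrame C e f) (hG : SimplicialFrame C e' f')
    (hC : CocompactCone C) (hcard : 3 ≤ Fintype.card ι) {x : V} (hx0 : x ≠ 0)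
    (hxC : x ∈ closure C) (hx : x ∈ Submodule.span ℝ (range e))
    (hx' : x ∈ Submodule.span ℝ (range e')) :
    ∃ y ∈ closure C, y ≠ 0 ∧ y ∉ C ∧ y ∈ Submodule.span ℝ (range e) ∧
      y ∈ Submodule.span ℝ (range e') := by
  set L := Submodule.span ℝ (range e) ⊓ Submodule.span ℝ (range e') with hL
  have hLdim : 2 ≤ Module.finrank ℝ L := by
    have h1 := Submodule.finrank_sup_add_finrank_inf_eq (Submodule.span ℝ (range e))
      (Submodule.span ℝ (range e'))
    rw [finrank_span_eq_card hF.linearIndependent, finrank_span_eq_card hG.linearIndependent,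
      ← hL] at h1
    have h2 := Submodule.finrank_le
      (Submodule.span ℝ (range e) ⊔ Submodule.span ℝ (range e'))
    have := hF.card_eq
    have := hG.card_eq
    omega
  obtain ⟨u, huL, hu⟩ : ∃ u ∈ L, u ∉ Submodule.span ℝ {x} := by
    by_contra! hn
    have h1 := Submodule.finrank_mono (show L ≤ Submodule.span ℝ {x} from hn)
    rw [finrank_span_singleton hx0] at h1
    omega
  obtain ⟨u, huL, hu, k, hk⟩ : ∃ u ∈ L, u ∉ Submodule.span ℝ {x} ∧ ∃ k, 0 < f k u := by
    obtain ⟨k, hk⟩ : ∃ k, f k u ≠ 0 := by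
      by_contra! hn
      refine hu ?_
      rw [hF.eq_sum_of_mem_span huL.1]
      simp [hn]
    rcases hk.lt_or_gt with hk | hk
    · exact ⟨-u, L.neg_mem huL, by rwa [Submodule.neg_mem_iff], k, by simpa using hk⟩
    · exact ⟨u, huL, hu, k, hk⟩
  obtain ⟨i, hi, hmin⟩ := Finset.exists_min_image (Finset.univ.filter fun i => 0 < f i u)
    (fun i => f i x / f i u) ⟨k, by simpa using hk⟩
  simp only [Finset.mem_filter, Finset.mem_univ, true_and] at hi hmin
  set s : ℝ := f i x / f i u with hs
  have hs0 : 0 ≤ s := div_nonneg (hF.form_nonneg i hxC) hi.le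
  have hyL : x - s • u ∈ L := L.sub_mem ⟨hx, hx'⟩ (L.smul_mem s huL)
  have hyi : f i (x - s • u) = 0 := by
    rw [map_sub, map_smul, hs, smul_eq_mul, div_mul_cancel₀ _ hi.ne', sub_self]
  refine ⟨x - s • u, ?_, fun h0 => ?_, fun h0 => (hF.form_pos hC i h0).ne' hyi, hyL.1, hyL.2⟩
  · rw [hF.eq_sum_of_mem_span hyL.1]
    refine hC.sum_mem_closure _ _ _ (fun m _ => ?_) fun m _ => hF.mem_closure m
    rw [map_sub, map_smul, smul_eq_mul, sub_nonneg]
    have hxm := hF.form_nonneg m hxC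
    rcases le_or_gt (f m u) 0 with hm | hm
    · exact (mul_nonpos_of_nonneg_of_nonpos hs0 hm).trans hxm
    · exact (le_div_iff₀ hm).1 (hmin m hm)
  · rw [sub_eq_zero] at h0
    rcases hs0.eq_or_lt with hs0 | hs0
    · exact hx0 (by rw [h0, ← hs0, zero_smul])
    · refine hu (Submodule.mem_span_singleton.2 ⟨s⁻¹, ?_⟩)
      rw [h0, smul_smul, inv_mul_cancel₀ hs0.ne', one_smul]

/-- In an indecomposable cone, two sections that meet have the same vertices. -/
theorem range_eq (hF : SimplicialFrame C e f) (hG : SimplicialFrame C e' f')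
    (hC : CocompactCone C) (hirr : ¬ IsSplitCone C) (hcard : 3 ≤ Fintype.card ι)
    {h : V →ₗ[ℝ] ℝ} (he : ∀ i, h (e i) = 1) (he' : ∀ j, h (e' j) = 1) {x : V} (hx0 : x ≠ 0)
    (hxC : x ∈ closure C) (hx : x ∈ Submodule.span ℝ (range e))
    (hx' : x ∈ Submodule.span ℝ (range e')) : range e = range e' := by
  obtain ⟨y, hy, hy0, hyC, hye, hye'⟩ :=
    hF.exists_common_boundary_point hG hC hcard hx0 hxC hx hx'
  obtain ⟨i, j, hij⟩ := hF.exists_common_vertex hG hC hirr (by omega) he he' hy0 hy hyC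
    (hF.eq_sum_of_mem_span hye) (hG.eq_sum_of_mem_span hye')
  have hcard' : 3 ≤ Fintype.card κ := by
    have := hF.card_eq
    have := hG.card_eq
    omega
  exact (hF.range_subset_of_common_vertex hG hC hirr hcard he he' hij).antisymm
    (hG.range_subset_of_common_vertex hF hC hirr hcard' he' he hij.symm)

end SimplicialFrame

end CocompactCone

section ConeOver

variable {d : ℕ} {Ω : Set (Euc d)}

lemma mem_coneOver {p : Euc d × ℝ} : p ∈ coneOver Ω ↔ 0 < p.2 ∧ p.2⁻¹ • p.1 ∈ Ω := by
  constructor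
  · rintro ⟨t, ht, x, hx, rfl⟩
    simpa [smul_smul, ht, ht.ne'] using hx
  · rintro ⟨hp, hx⟩
    exact ⟨p.2, hp, _, hx, by ext <;> simp [hp.ne']⟩

lemma mem_coneOver_one {x : Euc d} : (x, (1 : ℝ)) ∈ coneOver Ω ↔ x ∈ Ω := by
  simp [mem_coneOver]

lemma isOpen_coneOver (hop : IsOpen Ω) : IsOpen (coneOver Ω) := by
  rw [isOpen_iff_mem_nhds]
  intro p hp
  rw [mem_coneOver] at hp
  have hc : ContinuousAt (fun q : Euc d × ℝ => q.2⁻¹ • q.1) p :=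
    (continuousAt_snd.inv₀ hp.1.ne').smul continuousAt_fst
  filter_upwards [hc (hop.mem_nhds hp.2),
    (isOpen_lt continuous_const continuous_snd).mem_nhds hp.1] with q hq hq'
  exact mem_coneOver.2 ⟨hq', hq⟩

lemma smul_mem_coneOver (t : ℝ) (ht : 0 < t) (c : Euc d × ℝ) (hc : c ∈ coneOver Ω) :
    t • c ∈ coneOver Ω := by
  obtain ⟨s, hs, x, hx, rfl⟩ := hc
  exact ⟨t * s, mul_pos ht hs, x, hx, smul_smul _ _ _⟩

lemma convex_coneOver (hconv : Convex ℝ Ω) : Convex ℝ (coneOver Ω) := by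
  rw [convex_iff_forall_pos]
  rintro _ ⟨t, ht, x, hx, rfl⟩ _ ⟨s, hs, y, hy, rfl⟩ a b ha hb -
  have hat := mul_pos ha ht
  have hbs := mul_pos hb hs
  have h0 := add_pos hat hbs
  refine ⟨a * t + b * s, h0, _,
    hconv hx hy (a := a * t / (a * t + b * s)) (b := b * s / (a * t + b * s))
      (by positivity) (by positivity) (by field_simp), ?_⟩
  ext1
  · simp only [Prod.smul_mk, Prod.mk_add_mk, smul_add, smul_smul, mul_div_cancel₀ _ h0.ne']
  · simp

lemma Divides.cocompactCone {Γ : Subgroup ((Euc d × ℝ) ≃ₗ[ℝ] (Euc d × ℝ))}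
    (hdiv : Divides Ω Γ) (hne : Ω.Nonempty) (hbd : Bornology.IsBounded Ω) (hop : IsOpen Ω)
    (hconv : Convex ℝ Ω) : CocompactCone (coneOver Ω) where
  isOpen := isOpen_coneOver hop
  convex := convex_coneOver hconv
  nonempty := hne.imp' (fun x => (x, (1 : ℝ))) fun _ hx => mem_coneOver_one.2 hx
  smul_mem := smul_mem_coneOver
  sharp := by
    obtain ⟨R, hR⟩ := hbd.exists_norm_le
    refine ⟨(max R 1) • ContinuousLinearMap.snd ℝ (Euc d) ℝ, ?_⟩
    rintro _ ⟨t, ht, x, hx, rfl⟩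
    rw [norm_smul, Real.norm_of_nonneg ht.le, Prod.norm_mk, norm_one, mul_comm]
    simp only [FunLike.coe_smul, ContinuousLinearMap.coe_snd', Pi.smul_apply,
      Prod.smul_mk, smul_eq_mul, mul_one]
    exact mul_le_mul_of_nonneg_right (max_le_max (hR x hx) le_rfl) ht.le
  cocompact := by
    obtain ⟨hpres, -, -, K, hKΩ, hK, hcov⟩ := hdiv
    refine ⟨(fun x => (x, (1 : ℝ))) '' K, ?_, hK.image (by fun_prop), ?_⟩
    · rintro _ ⟨x, hx, rfl⟩
      exact mem_coneOver_one.2 (hKΩ hx)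
    rintro _ ⟨t, ht, y, hy, rfl⟩
    rw [← hcov] at hy
    simp only [mem_iUnion, mem_image] at hy
    obtain ⟨γ, hγ, k, hk, rfl⟩ := hy
    have hmem : ∀ v, γ v ∈ coneOver Ω ↔ v ∈ coneOver Ω := fun v => by
      conv_lhs => rw [← hpres γ hγ]
      exact γ.injective.mem_set_image
    have hs : 0 < (γ (k, 1)).2 :=
      (mem_coneOver.1 ((hmem _).2 (mem_coneOver_one.2 (hKΩ hk)))).1
    have hr : 0 < t / (γ (k, 1)).2 := div_pos ht hs
    refine ⟨(γ.trans (LinearEquiv.smulOfNeZero ℝ (Euc d × ℝ) _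
      hr.ne')).toContinuousLinearEquiv, fun v => ?_, (k, 1), mem_image_of_mem _ hk, ?_⟩
    · rw [← hmem v]
      refine ⟨fun h => ?_, fun h => smul_mem_coneOver _ hr _ h⟩
      have h' := smul_mem_coneOver _ (inv_pos.2 hr) _ h
      simpa [smul_smul, hr.ne', ht.ne', hs.ne'] using h'
    · ext1
      · simp [projAct, smul_smul, div_eq_mul_inv]
      · simp [hs.ne']

end ConeOver

section Flat

lemma exists_weights_of_mem_convexHull_range {E ι : Type*} [AddCommGroup E] [Module ℝ E]
    [Fintype ι] {v : ι → E} {x : E} (hx : x ∈ convexHull ℝ (range v)) :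
    ∃ w : ι → ℝ, (∀ i, 0 ≤ w i) ∧ ∑ i, w i = 1 ∧ ∑ i, w i • v i = x := by
  refine convexHull_min (t := {x | ∃ w : ι → ℝ, (∀ i, 0 ≤ w i) ∧ ∑ i, w i = 1 ∧
    ∑ i, w i • v i = x}) ?_ ?_ hx
  · classical
    rintro _ ⟨i, rfl⟩
    exact ⟨Pi.single i 1, fun j => by
      by_cases h : j = i <;> simp [h], by simp, by simp [Pi.single_apply]⟩
  · rintro _ ⟨w, hw, hw1, rfl⟩ _ ⟨u, hu, hu1, rfl⟩ a b ha hb hab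
    refine ⟨fun i => a * w i + b * u i, fun i => ?_, ?_, ?_⟩
    · have := hw i; have := hu i; positivity
    · rw [Finset.sum_add_distrib, ← Finset.mul_sum, ← Finset.mul_sum, hw1, hu1]
      linarith
    · simp_rw [add_smul, mul_smul, Finset.sum_add_distrib, Finset.smul_sum]

/-- Points of the relative interior of a simplex have nonzero barycentric coordinates. -/
lemma AffineIndependent.weight_ne_zero_of_mem_intrinsicInterior {E ι : Type*}
    [NormedAddCommGroup E] [NormedSpace ℝ E] [Fintype ι] {v : ι → E}
    (hv : AffineIndependent ℝ v) {w : ι → ℝ} (hw : ∑ i, w i = 1)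
    (hx : ∑ i, w i • v i ∈ intrinsicInterior ℝ (convexHull ℝ (range v))) (i : ι) : w i ≠ 0 := by
  classical
  intro hi
  obtain ⟨y, hy, hyx⟩ := mem_intrinsicInterior.1 hx
  have hvi : v i ∈ affineSpan ℝ (convexHull ℝ (range v)) :=
    subset_affineSpan _ _ (subset_convexHull _ _ (mem_range_self i))
  let p : ℝ → affineSpan ℝ (convexHull ℝ (range v)) := fun t =>
    ⟨AffineMap.lineMap (y : E) (v i) (-t), AffineMap.lineMap_mem _ y.2 hvi⟩
  have hp : Continuous p := by
    refine Continuous.subtype_mk ?_ _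
    simp only [AffineMap.lineMap_apply_module]
    fun_prop
  have hp0 : p 0 = y := Subtype.ext (by simp [p])
  have hev : ∀ᶠ t in nhds (0 : ℝ), p t ∈ interior (Subtype.val ⁻¹' convexHull ℝ (range v)) :=
    hp.continuousAt.eventually_mem (isOpen_interior.mem_nhds (hp0 ▸ hy))
  obtain ⟨t, htp, ht⟩ := ((hev.filter_mono nhdsWithin_le_nhds).and
    (self_mem_nhdsWithin (s := Ioi (0 : ℝ)))).exists
  have htm : (p t : E) ∈ convexHull ℝ (range v) :=
    interior_subset (s := Subtype.val ⁻¹' convexHull ℝ (range v)) htp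
  obtain ⟨u, hu, hu1, hux⟩ := exists_weights_of_mem_convexHull_range htm
  have key := hv.eq_zero_of_sum_eq_zero (s := Finset.univ)
    (w := fun j => u j - ((1 + t) * w j - t * if j = i then 1 else 0)) (by
      simp only [Finset.sum_sub_distrib, ← Finset.mul_sum, hu1, hw]
      simp) (by
      simp only [sub_smul, Finset.sum_sub_distrib, hux, mul_smul, ← Finset.smul_sum, ← hyx, p,
        AffineMap.lineMap_apply_module, ite_smul, one_smul, zero_smul, Finset.sum_ite_eq',
        Finset.mem_univ, if_true]
      module) i (Finset.mem_univ i)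
  have := hu i
  simp only [hi, if_true] at key
  have : 0 < t := ht
  linarith

variable {d : ℕ} {Ω : Set (Euc d)} {v : Fin d → Euc d}

lemma mem_closure_coneOver {x : Euc d} (hx : x ∈ closure Ω) :
    (x, (1 : ℝ)) ∈ closure (coneOver Ω) :=
  map_mem_closure (f := fun y => (y, (1 : ℝ))) (by fun_prop) hx fun _ hy => mem_coneOver_one.2 hy

lemma IsFlatWith.mem_closure (h : IsFlatWith Ω v) (j : Fin d) :
    (v j, (1 : ℝ)) ∈ closure (coneOver Ω) :=
  mem_closure_coneOver (h.2.1 j).1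

lemma sum_smul_lift (w : Fin d → ℝ) :
    ∑ j, w j • (v j, (1 : ℝ)) = (∑ j, w j • v j, ∑ j, w j) := by
  ext1 <;> simp [Prod.fst_sum, Prod.snd_sum]

lemma IsFlatWith.mem_of_pos (h : IsFlatWith Ω v) (hC : CocompactCone (coneOver Ω)) (hd : 0 < d)
    (a : Fin d → ℝ) (ha : ∀ j, 0 < a j) : ∑ j, a j • (v j, (1 : ℝ)) ∈ coneOver Ω := by
  have : Nonempty (Fin d) := ⟨⟨0, hd⟩⟩
  obtain ⟨z, hz⟩ := (range_nonempty v).convexHull.intrinsicInterior (convex_convexHull ℝ (range v))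
  obtain ⟨w, hw, hw1, hwz⟩ :=
    exists_weights_of_mem_convexHull_range (intrinsicInterior_subset hz)
  obtain ⟨i, hi⟩ := Finite.exists_min a
  have hw' : ∀ j, w j ≤ 1 := fun j =>
    hw1 ▸ Finset.single_le_sum (fun k _ => hw k) (Finset.mem_univ j)
  have hzC := smul_mem_coneOver _ (ha i) _ (mem_coneOver_one.2 (h.2.2.1 hz))
  have := hC.add_mem hzC (hC.sum_mem_closure Finset.univ (fun j => a j - a i * w j)
    (fun j => (v j, (1 : ℝ)))
    (fun j _ => by nlinarith [hi j, hw' j, ha i]) fun j _ => h.mem_closure j)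
  convert this using 1
  have hz' : (z, (1 : ℝ)) = ∑ j, w j • (v j, (1 : ℝ)) := by rw [sum_smul_lift, hwz, hw1]
  simp only [hz', Finset.smul_sum, sub_smul, mul_smul, Finset.sum_sub_distrib]
  abel

lemma IsFlatWith.exists_form (h : IsFlatWith Ω v) (hC : CocompactCone (coneOver Ω)) (hd : 2 ≤ d)
    (i : Fin d) : ∃ f : (Euc d × ℝ) →ₗ[ℝ] ℝ, (∀ c ∈ coneOver Ω, 0 ≤ f c) ∧
      ∀ j, f (v j, 1) = if i = j then 1 else 0 := by
  have hd1 : (0 : ℝ) < d - 1 := by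
    have : (2 : ℝ) ≤ d := by exact_mod_cast hd
    linarith
  let w : Fin d → ℝ := fun j => if j = i then 0 else ((d : ℝ) - 1)⁻¹
  have hw0 : ∀ j, 0 ≤ w j := fun j => by
    dsimp only [w]; split_ifs <;> positivity
  have hw1 : ∑ j, w j = 1 := by
    simp only [w, Finset.sum_ite, Finset.sum_const_zero, Finset.sum_const, zero_add, nsmul_eq_mul]
    rw [Finset.filter_ne' Finset.univ i, Finset.card_erase_of_mem (Finset.mem_univ i),
      Finset.card_univ, Fintype.card_fin, Nat.cast_sub (by omega), Nat.cast_one,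
      mul_inv_cancel₀ hd1.ne']
  have hmc : ∑ j, w j • v j ∈ convexHull ℝ (range v) :=
    (convex_convexHull ℝ _).sum_mem (fun j _ => hw0 j) hw1
      fun j _ => subset_convexHull _ _ (mem_range_self j)
  have hmi : ∑ j, w j • v j ∉ intrinsicInterior ℝ (convexHull ℝ (range v)) := fun hm =>
    h.1.weight_ne_zero_of_mem_intrinsicInterior hw1 hm i (by simp [w])
  have hm := h.2.2.2 ⟨hmc, hmi⟩
  set m := ∑ j, w j • v j with hm_def
  obtain ⟨g, hg⟩ := geometric_hahn_banach_open_point hC.convex hC.isOpen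
    (mt mem_coneOver_one.1 hm.2)
  have hg0 : ∀ c ∈ coneOver Ω, g c ≤ 0 := fun c hc => by
    by_contra! hpos
    have := hg _ (hC.smul_mem ((|g (m, 1)| + 1) / g c) (by positivity) c hc)
    rw [map_smul, smul_eq_mul, div_mul_cancel₀ _ hpos.ne'] at this
    linarith [le_abs_self (g (m, 1))]
  let f : (Euc d × ℝ) →ₗ[ℝ] ℝ := -(g : (Euc d × ℝ) →ₗ[ℝ] ℝ)
  have hf : ∀ c ∈ coneOver Ω, 0 ≤ f c := fun c hc => by simpa [f] using hg0 c hc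
  have hfcl : ∀ j, 0 ≤ f (v j, 1) := fun j =>
    CocompactCone.nonneg_of_mem_closure hf (h.mem_closure j)
  have hlift : (m, (1 : ℝ)) = ∑ j, w j • (v j, (1 : ℝ)) := by rw [sum_smul_lift, hw1]
  have hgm : 0 ≤ g (m, 1) := by
    obtain ⟨c, hc⟩ := hC.nonempty
    have ht : Tendsto (fun t : ℝ => t * g c) (nhdsWithin 0 (Ioi 0)) (nhds (0 * g c)) :=
      ((continuous_id.mul continuous_const).tendsto 0).mono_left nhdsWithin_le_nhds
    rw [zero_mul] at ht
    refine le_of_tendsto ht ?_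
    filter_upwards [self_mem_nhdsWithin] with t ht
    simpa using (hg _ (hC.smul_mem t ht c hc)).le
  have hfm : ∑ j, w j * f (v j, 1) ≤ 0 := by
    have : f (m, 1) = ∑ j, w j * f (v j, 1) := by simp only [hlift, map_sum, map_smul, smul_eq_mul]
    rw [← this]
    simpa [f] using hgm
  have hfj : ∀ j, j ≠ i → f (v j, 1) = 0 := fun j hj => by
    have := (Finset.sum_eq_zero_iff_of_nonneg
      (fun j _ => mul_nonneg (hw0 j) (hfcl j))).1
      (hfm.antisymm (Finset.sum_nonneg fun j _ => mul_nonneg (hw0 j) (hfcl j))) j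
      (Finset.mem_univ j)
    simpa [w, hj, hd1.ne'] using this
  have hfne : f ≠ 0 := by
    obtain ⟨c, hc⟩ := hC.nonempty
    intro h0
    have h1 : ∀ c, g c = 0 := fun c => by
      simpa [f] using LinearMap.congr_fun h0 c
    simpa [h1] using hg c hc
  have hpos : 0 < f (v i, 1) := by
    have := hC.pos_of_nonneg hf hfne
      (h.mem_of_pos hC (by omega) (fun _ => 1) fun _ => one_pos)
    rw [map_sum, Finset.sum_eq_single i (fun j _ hj => by simp [hfj j hj]) (by simp)] at this
    simpa using this
  refine ⟨(f (v i, 1))⁻¹ • f, fun c hc => ?_, fun j => ?_⟩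
  · exact mul_nonneg (inv_nonneg.2 hpos.le) (hf c hc)
  · by_cases hij : i = j
    · subst hij
      simp [hpos.ne']
    · simp [hij, hfj j (Ne.symm hij)]

lemma IsFlatWith.exists_simplicialFrame (h : IsFlatWith Ω v) (hC : CocompactCone (coneOver Ω))
    (hd : 2 ≤ d) : ∃ f, SimplicialFrame (coneOver Ω) (fun j => (v j, (1 : ℝ))) f := by
  choose f hf hdual using h.exists_form hC hd
  exact ⟨f, h.mem_closure, hf, hdual, h.mem_of_pos hC (by omega), by simp⟩

lemma lift_mem_span {x : Euc d} (hx : x ∈ convexHull ℝ (range v)) :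
    (x, (1 : ℝ)) ∈ Submodule.span ℝ (range fun j => (v j, (1 : ℝ))) := by
  obtain ⟨w, -, hw1, rfl⟩ := exists_weights_of_mem_convexHull_range hx
  have hlift := sum_smul_lift (v := v) w
  rw [hw1] at hlift
  rw [← hlift]
  exact Submodule.sum_mem _ fun j _ =>
    Submodule.smul_mem _ _ (Submodule.subset_span (mem_range_self j))

lemma closure_intrinsicInterior_subset :
    closure (intrinsicInterior ℝ (convexHull ℝ (range v))) ⊆ convexHull ℝ (range v) :=
  closure_minimal intrinsicInterior_subset
    ((finite_range v).isCompact_convexHull ℝ).isClosed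

end Flat

theorem closures_of_distinct_flats_disjoint {d : ℕ} (Ω : Set (Euc d)) (hne : Ω.Nonempty)
    (hbd : Bornology.IsBounded Ω) (hop : IsOpen Ω) (hconv : Convex ℝ Ω)
    (hd : 3 ≤ d) (hirr : IsIrreducibleDomain Ω)
    (Γ : Subgroup ((Euc d × ℝ) ≃ₗ[ℝ] (Euc d × ℝ)))
    (htf : TorsionFreeSub Γ) (hdiv : Divides Ω Γ)
    (F₁ F₂ : Set (Euc d)) (hF₁ : IsFlat Ω F₁) (hF₂ : IsFlat Ω F₂) (hne12 : F₁ ≠ F₂) :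
    closure F₁ ∩ closure F₂ = ∅ := by
  rw [eq_empty_iff_forall_notMem]
  rintro x ⟨hx₁, hx₂⟩
  obtain ⟨v, hv, rfl⟩ := hF₁
  obtain ⟨w, hw, rfl⟩ := hF₂
  have hC := hdiv.cocompactCone hne hbd hop hconv
  obtain ⟨f, hf⟩ := hv.exists_simplicialFrame hC (by omega)
  obtain ⟨g, hg⟩ := hw.exists_simplicialFrame hC (by omega)
  have hrange := hf.range_eq hg hC hirr (by simpa using hd) (h := LinearMap.snd ℝ (Euc d) ℝ)
    (fun _ => rfl) (fun _ => rfl) (x := (x, 1)) (fun h0 => one_ne_zero (congrArg Prod.snd h0))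
    (mem_closure_coneOver (closure_mono hv.2.2.1 hx₁))
    (lift_mem_span (closure_intrinsicInterior_subset hx₁))
    (lift_mem_span (closure_intrinsicInterior_subset hx₂))
  have himage := congrArg (image Prod.fst) hrange
  rw [← range_comp, ← range_comp] at himage
  exact hne12 (congrArg (fun s => intrinsicInterior ℝ (convexHull ℝ s)) himage)
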